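/- arXiv:1008.2040 — 2 statements merged into one kernel-verified Lean document; each statement's English description precedes it below -/
import Mathlib

section
/- Let P = {(x,y) ∈ ℝ² : x² + y² ≤ 1, y ≥ 0} be the closed unit semidisc. Then V_P(r) = π/2 − (1−r)² arccos(r/(1−r)) + r√(1−2r) for 0 ≤ r ≤ 1/2, and V_P(r) = π/2 for r ≥ 1/2. Moreover, V_P is of class C¹ on [0,∞) but not of class C², since lim_{r→(1/2)⁻} V_P''(r) = −∞. -/
open MeasureTheory Metric Set Real Filter
open scoped RealInnerProductSpace Topology

/-- The `r`-interior of a set `P`: points of `P` at distance at least `r` from `∂P`. -/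
noncomputable def innerInterior {d : ℕ} (P : Set (EuclideanSpace ℝ (Fin d))) (r : ℝ) :
    Set (EuclideanSpace ℝ (Fin d)) :=
  {x ∈ P | r ≤ infDist x (frontier P)}

/-- The inner neighborhood volume function `V_P(r) = vol_d(P \ P(r))`. -/
noncomputable def VP {d : ℕ} (P : Set (EuclideanSpace ℝ (Fin d))) (r : ℝ) : ℝ :=
  (volume (P \ innerInterior P r)).toReal

/-- The part of the closed disc of radius `R` around the origin at height at least `h`. -/
def diskCap (R h : ℝ) : Set (EuclideanSpace ℝ (Fin 2)) :=
  {x | x 0 ^ 2 + x 1 ^ 2 ≤ R ^ 2 ∧ h ≤ x 1}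

theorem isClosed_diskCap (R h : ℝ) : IsClosed (diskCap R h) := by
  rw [diskCap, ofPred_and]
  exact (isClosed_le (by fun_prop) (by fun_prop)).inter (isClosed_le (by fun_prop) (by fun_prop))

theorem hasDerivAt_mul_sqrt_sub_arccos {R y : ℝ} (hy : |y| < R) :
    HasDerivAt (fun y => y * √(R ^ 2 - y ^ 2) - R ^ 2 * arccos (y / R))
      (2 * √(R ^ 2 - y ^ 2)) y := by
  obtain ⟨hy₁, hy₂⟩ := abs_lt.1 hy
  have hR : 0 < R := (abs_nonneg y).trans_lt hy
  have hpos : 0 < R ^ 2 - y ^ 2 := by nlinarith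
  have hsqrt : √(1 - (y / R) ^ 2) = √(R ^ 2 - y ^ 2) / R := by
    rw [show 1 - (y / R) ^ 2 = (R ^ 2 - y ^ 2) / R ^ 2 by field_simp,
      sqrt_div hpos.le, sqrt_sq hR.le]
  have h₁ : HasDerivAt (fun y => √(R ^ 2 - y ^ 2)) (-(2 * y) / (2 * √(R ^ 2 - y ^ 2))) y := by
    simpa using (((hasDerivAt_id y).pow 2).const_sub (R ^ 2)).sqrt hpos.ne'
  have h₂ := (hasDerivAt_arccos (x := y / R)
    (by rw [ne_eq, div_eq_iff hR.ne']; linarith)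
    (by rw [ne_eq, div_eq_iff hR.ne']; linarith)).comp y ((hasDerivAt_id y).div_const R)
  refine (((hasDerivAt_id y).mul h₁).sub (h₂.const_mul (R ^ 2))).congr_deriv ?_
  rw [hsqrt]
  have hs : 0 < √(R ^ 2 - y ^ 2) := sqrt_pos.2 hpos
  have hs2 := sq_sqrt hpos.le
  simp only [id]
  field_simp
  linarith

theorem integral_two_mul_sqrt_sq_sub_sq {R h : ℝ} (hR : 0 < R) (hh : -R ≤ h) (hhR : h ≤ R) :
    ∫ y in h..R, 2 * √(R ^ 2 - y ^ 2) = R ^ 2 * arccos (h / R) - h * √(R ^ 2 - h ^ 2) := by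
  rw [intervalIntegral.integral_eq_sub_of_hasDerivAt_of_le
    (f := fun y => y * √(R ^ 2 - y ^ 2) - R ^ 2 * arccos (y / R)) hhR (by fun_prop)
    (fun y hy => hasDerivAt_mul_sqrt_sub_arccos
      (abs_lt.2 ⟨by linarith [hy.1], hy.2⟩))
    (Continuous.intervalIntegrable (by fun_prop) _ _)]
  simp [div_self hR.ne']

theorem volume_diskCap {R h : ℝ} (hR : 0 < R) (hh : -R ≤ h) (hhR : h ≤ R) :
    volume (diskCap R h) =
      ENNReal.ofReal (R ^ 2 * arccos (h / R) - h * √(R ^ 2 - h ^ 2)) := by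
  let T : Set (ℝ × ℝ) := {p | p.1 ^ 2 + p.2 ^ 2 ≤ R ^ 2 ∧ h ≤ p.2}
  have hT : MeasurableSet T := by
    simp only [T, ofPred_and]
    exact (measurableSet_le (by fun_prop) (by fun_prop)).inter
      (measurableSet_le (by fun_prop) (by fun_prop))
  have hmp := (volume_preserving_finTwoArrow ℝ).comp (PiLp.volume_preserving_ofLp (Fin 2))
  have hpre : diskCap R h = (MeasurableEquiv.finTwoArrow ∘ WithLp.ofLp) ⁻¹' T := rfl
  have hslice : ∀ y : ℝ, volume ((fun x => (x, y)) ⁻¹' T) =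
      (Icc h R).indicator (fun y => ENNReal.ofReal (2 * √(R ^ 2 - y ^ 2))) y := by
    intro y
    by_cases hy : y ∈ Icc h R
    · have hnn : 0 ≤ R ^ 2 - y ^ 2 := by nlinarith [hy.1, hy.2]
      have : (fun x => (x, y)) ⁻¹' T = Icc (-√(R ^ 2 - y ^ 2)) √(R ^ 2 - y ^ 2) := by
        ext x
        rw [mem_Icc, ← abs_le, ← sqrt_sq_eq_abs, sqrt_le_sqrt_iff hnn]
        exact ⟨fun hx => by linarith [hx.1], fun hx => ⟨by simpa using by linarith, hy.1⟩⟩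
      rw [this, indicator_of_mem hy, Real.volume_Icc]
      ring_nf
    · have : (fun x => (x, y)) ⁻¹' T = ∅ := by
        refine eq_empty_of_forall_notMem fun x hx => hy ⟨hx.2, ?_⟩
        have : x ^ 2 + y ^ 2 ≤ R ^ 2 := hx.1
        exact (abs_le_of_sq_le_sq' (by nlinarith [sq_nonneg x]) hR.le).2
      rw [this, indicator_of_notMem hy, measure_empty]
  rw [hpre, hmp.measure_preimage hT.nullMeasurableSet, Measure.volume_eq_prod,
    Measure.prod_apply_symm hT, lintegral_congr hslice, lintegral_indicator measurableSet_Icc,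
    ← ofReal_integral_eq_lintegral_ofReal
      (Continuous.integrableOn_Icc (by fun_prop)) (ae_of_all _ fun _ => by positivity),
    integral_Icc_eq_integral_Ioc, ← intervalIntegral.integral_of_le hhR,
    integral_two_mul_sqrt_sq_sub_sq hR hh hhR]

theorem sq_add_sq_eq_norm_sq (x : EuclideanSpace ℝ (Fin 2)) : x 0 ^ 2 + x 1 ^ 2 = ‖x‖ ^ 2 := by
  simp [EuclideanSpace.norm_sq_eq]

theorem mem_diskCap {R h : ℝ} (hR : 0 ≤ R) {x : EuclideanSpace ℝ (Fin 2)} :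
    x ∈ diskCap R h ↔ ‖x‖ ≤ R ∧ h ≤ x 1 := by
  rw [diskCap, mem_ofPred_eq, sq_add_sq_eq_norm_sq, sq_le_sq₀ (norm_nonneg x) hR]

theorem interior_diskCap {R h : ℝ} (hR : 0 < R) :
    interior (diskCap R h) = {x | ‖x‖ < R ∧ h < x 1} := by
  have : diskCap R h = closedBall 0 R ∩ (fun x : EuclideanSpace ℝ (Fin 2) => x 1) ⁻¹' Ici h := by
    ext x
    simp [mem_diskCap hR.le]
  rw [this, interior_inter, interior_closedBall _ hR.ne',
    ← (PiLp.isOpenMap_apply 2 _ 1).preimage_interior_eq_interior_preimage (by fun_prop),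
    interior_Ici]
  ext x
  simp

theorem mem_frontier_diskCap {R h : ℝ} (hR : 0 < R) {x : EuclideanSpace ℝ (Fin 2)} :
    x ∈ frontier (diskCap R h) ↔ (‖x‖ ≤ R ∧ h ≤ x 1) ∧ (‖x‖ = R ∨ x 1 = h) := by
  rw [(isClosed_diskCap R h).frontier_eq, interior_diskCap hR, Set.mem_sdiff, mem_diskCap hR.le,
    mem_ofPred_eq, not_and_or, not_lt, not_lt]
  grind

theorem innerInterior_diskCap {r : ℝ} (hr : 0 ≤ r) :
    innerInterior (diskCap 1 0) r = {x | ‖x‖ ≤ 1 - r ∧ r ≤ x 1} := by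
  have hne : (frontier (diskCap 1 0)).Nonempty :=
    ⟨0, (mem_frontier_diskCap one_pos).2 (by simp)⟩
  ext x
  rw [innerInterior, mem_ofPred_eq, le_infDist hne, mem_diskCap zero_le_one, mem_ofPred_eq]
  constructor
  · rintro ⟨⟨hx, hx1⟩, hd⟩
    have hr1 : r ≤ x 1 := by
      have hmem : !₂[x 0, 0] ∈ frontier (diskCap 1 0) := by
        refine (mem_frontier_diskCap one_pos).2 ⟨⟨?_, by simp⟩, Or.inr (by simp)⟩
        rw [← sq_le_sq₀ (norm_nonneg _) zero_le_one, ← sq_add_sq_eq_norm_sq] at hx ⊢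
        simp only [Matrix.cons_val_zero, Matrix.cons_val_one]
        nlinarith [sq_nonneg (x 1)]
      have := hd hmem
      simpa [EuclideanSpace.dist_eq, abs_of_nonneg hx1, sqrt_sq hx1] using this
    refine ⟨?_, hr1⟩
    rcases eq_or_ne x 0 with rfl | hx0
    · have : r ≤ 0 := by simpa using hr1
      simp; linarith
    · have hpos : 0 < ‖x‖ := norm_pos_iff.2 hx0
      have hmem : ‖x‖⁻¹ • x ∈ frontier (diskCap 1 0) := by
        have hnorm : ‖‖x‖⁻¹ • x‖ = 1 := by
          rw [norm_smul, norm_inv, norm_norm, inv_mul_cancel₀ hpos.ne']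
        refine (mem_frontier_diskCap one_pos).2 ⟨⟨hnorm.le, ?_⟩, Or.inl hnorm⟩
        simpa using by positivity
      have := hd hmem
      rw [dist_comm, dist_eq_norm,
        show ‖x‖⁻¹ • x - x = (‖x‖⁻¹ - 1) • x by rw [sub_smul, one_smul], norm_smul,
        norm_of_nonneg (sub_nonneg.2 ((one_le_inv₀ hpos).2 hx)), sub_mul,
        inv_mul_cancel₀ hpos.ne'] at this
      linarith
  · rintro ⟨hx, hx1⟩
    refine ⟨⟨by linarith, by linarith⟩, fun y hy => ?_⟩
    obtain ⟨-, hy | hy⟩ := (mem_frontier_diskCap one_pos).1 hy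
    · have := norm_sub_norm_le y x
      rw [dist_comm, dist_eq_norm]
      linarith
    · have := PiLp.norm_apply_le (x - y) 1
      rw [dist_eq_norm]
      rw [PiLp.sub_apply, hy, sub_zero] at this
      exact hx1.trans ((le_abs_self _).trans this)

/-- The closed form of `V_P` on `[0, 1/2]` for the unit semidisc. -/
noncomputable def semidiscVP (r : ℝ) : ℝ :=
  π / 2 - (1 - r) ^ 2 * arccos (r / (1 - r)) + r * √(1 - 2 * r)

theorem volume_semidisc : volume (diskCap 1 0) = ENNReal.ofReal (π / 2) := by
  rw [volume_diskCap one_pos (by norm_num) zero_le_one]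
  simp

theorem VP_diskCap_of_le {r : ℝ} (hr : 0 ≤ r) (hr' : r ≤ 1 / 2) :
    VP (diskCap 1 0) r = semidiscVP r := by
  have hset : innerInterior (diskCap 1 0) r = diskCap (1 - r) r := by
    ext x
    rw [innerInterior_diskCap hr, mem_diskCap (by linarith), mem_ofPred_eq]
  have hsub : diskCap (1 - r) r ⊆ diskCap 1 0 := fun x hx => by
    rw [mem_diskCap (by linarith)] at hx ⊢
    exact ⟨by linarith, by linarith⟩
  have hvol := volume_diskCap (R := 1 - r) (h := r) (by linarith) (by linarith) (by linarith)
  rw [show (1 - r) ^ 2 - r ^ 2 = 1 - 2 * r by ring] at hvol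
  have hnn : 0 ≤ (1 - r) ^ 2 * arccos (r / (1 - r)) - r * √(1 - 2 * r) := by
    rw [show 1 - 2 * r = (1 - r) ^ 2 - r ^ 2 by ring, ← integral_two_mul_sqrt_sq_sub_sq
      (by linarith) (by linarith) (by linarith)]
    exact intervalIntegral.integral_nonneg (by linarith) fun _ _ => by positivity
  rw [VP, hset, ← measureReal_def, measureReal_sdiff hsub (isClosed_diskCap _ _).measurableSet
    (by rw [volume_semidisc]; finiteness), measureReal_def, measureReal_def, volume_semidisc, hvol,
    ENNReal.toReal_ofReal hnn, ENNReal.toReal_ofReal (by positivity), semidiscVP]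
  ring

theorem semidiscVP_one_half : semidiscVP (1 / 2) = π / 2 := by
  norm_num [semidiscVP]

theorem VP_diskCap_of_ge {r : ℝ} (hr : 1 / 2 ≤ r) : VP (diskCap 1 0) r = π / 2 := by
  have hfin : volume (diskCap 1 0) ≠ ⊤ := by rw [volume_semidisc]; finiteness
  apply le_antisymm
  · have := ENNReal.toReal_mono hfin (measure_mono (sdiff_subset (s := diskCap 1 0)
      (t := innerInterior (diskCap 1 0) r)))
    rwa [volume_semidisc, ENNReal.toReal_ofReal (by positivity)] at this
  · rw [← semidiscVP_one_half, ← VP_diskCap_of_le (by norm_num) le_rfl]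
    refine ENNReal.toReal_mono (measure_ne_top_of_subset sdiff_subset hfin)
      (measure_mono (sdiff_subset_sdiff_right fun x hx => ⟨hx.1, hr.trans hx.2⟩))

theorem VP_diskCap {r : ℝ} (hr : 0 ≤ r) :
    VP (diskCap 1 0) r = semidiscVP (min r (1 / 2)) := by
  rcases le_total r (1 / 2) with h | h
  · rw [min_eq_left h, VP_diskCap_of_le hr h]
  · rw [min_eq_right h, VP_diskCap_of_ge h, semidiscVP_one_half]

/-- The derivative of `semidiscVP`: the perimeter of the inner parallel set. -/
noncomputable def semidiscPerimeter (r : ℝ) : ℝ :=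
  2 * (1 - r) * arccos (r / (1 - r)) + 2 * √(1 - 2 * r)

theorem hasDerivAt_arccos_div_one_sub {r : ℝ} (hr : r < 1 / 2) :
    HasDerivAt (fun r => arccos (r / (1 - r))) (-(1 / ((1 - r) * √(1 - 2 * r)))) r := by
  have hR : 0 < 1 - r := by linarith
  have hpos : 0 < 1 - 2 * r := by linarith
  have hsqrt : √(1 - (r / (1 - r)) ^ 2) = √(1 - 2 * r) / (1 - r) := by
    rw [show 1 - (r / (1 - r)) ^ 2 = (1 - 2 * r) / (1 - r) ^ 2 by field_simp; ring,
      sqrt_div hpos.le, sqrt_sq hR.le]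
  have h := (hasDerivAt_arccos (x := r / (1 - r))
    (by rw [ne_eq, div_eq_iff hR.ne']; linarith)
    (by rw [ne_eq, div_eq_iff hR.ne']; linarith)).comp r
      ((hasDerivAt_id r).div ((hasDerivAt_id r).const_sub 1) hR.ne')
  refine h.congr_deriv ?_
  rw [hsqrt]
  have hs : 0 < √(1 - 2 * r) := sqrt_pos.2 hpos
  simp only [id]
  field_simp
  ring

theorem hasDerivAt_sqrt_one_sub_two_mul {r : ℝ} (hr : r < 1 / 2) :
    HasDerivAt (fun r => √(1 - 2 * r)) (-(1 / √(1 - 2 * r))) r := by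
  have hpos : 0 < 1 - 2 * r := by linarith
  refine ((((hasDerivAt_id r).const_mul 2).const_sub 1).sqrt hpos.ne').congr_deriv ?_
  have hs : 0 < √(1 - 2 * r) := sqrt_pos.2 hpos
  simp only [id]
  field_simp

theorem hasDerivAt_semidiscVP {r : ℝ} (hr : r < 1 / 2) :
    HasDerivAt semidiscVP (semidiscPerimeter r) r := by
  have hpos : 0 < 1 - 2 * r := by linarith
  have hR : 0 < 1 - r := by linarith
  have h := (((((hasDerivAt_id r).const_sub 1).pow 2).mul
    (hasDerivAt_arccos_div_one_sub hr)).const_sub (π / 2)).add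
      ((hasDerivAt_id r).mul (hasDerivAt_sqrt_one_sub_two_mul hr))
  refine h.congr_deriv ?_
  have hs : 0 < √(1 - 2 * r) := sqrt_pos.2 hpos
  have hs2 := sq_sqrt hpos.le
  simp only [id, semidiscPerimeter, Pi.pow_apply, Nat.cast_ofNat, Nat.add_one_sub_one, pow_one]
  field_simp
  linear_combination (-1) * hs2

theorem hasDerivAt_semidiscPerimeter {r : ℝ} (hr : r < 1 / 2) :
    HasDerivAt semidiscPerimeter (-2 * arccos (r / (1 - r)) - 4 / √(1 - 2 * r)) r := by
  have hpos : 0 < 1 - 2 * r := by linarith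
  have hR : 0 < 1 - r := by linarith
  have h := ((((hasDerivAt_id r).const_sub 1).const_mul 2).mul
    (hasDerivAt_arccos_div_one_sub hr)).add
      ((hasDerivAt_sqrt_one_sub_two_mul hr).const_mul 2)
  refine h.congr_deriv ?_
  have hs : 0 < √(1 - 2 * r) := sqrt_pos.2 hpos
  simp only [id]
  field_simp
  ring

theorem continuous_min_div_one_sub_min :
    Continuous fun r : ℝ => min r (1 / 2) / (1 - min r (1 / 2)) :=
  Continuous.div (by fun_prop) (by fun_prop) fun r => by
    have := min_le_right r (1 / 2)
    linarith

theorem continuous_semidiscVP_min : Continuous fun r => semidiscVP (min r (1 / 2)) := by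
  have := continuous_min_div_one_sub_min
  unfold semidiscVP
  fun_prop

theorem continuous_semidiscPerimeter_min :
    Continuous fun r => semidiscPerimeter (min r (1 / 2)) := by
  have := continuous_min_div_one_sub_min
  unfold semidiscPerimeter
  fun_prop

theorem hasDerivAt_semidiscVP_min (r : ℝ) :
    HasDerivAt (fun r => semidiscVP (min r (1 / 2))) (semidiscPerimeter (min r (1 / 2))) r := by
  refine hasDerivAt_of_hasDerivAt_of_ne' (g := fun r => semidiscPerimeter (min r (1 / 2)))
    (x := 1 / 2) (fun y hy => ?_)
    continuous_semidiscVP_min.continuousAt continuous_semidiscPerimeter_min.continuousAt r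
  rcases hy.lt_or_gt with hy | hy
  · rw [min_eq_left hy.le]
    refine (hasDerivAt_semidiscVP hy).congr_of_eventuallyEq ?_
    filter_upwards [Iio_mem_nhds hy] with z hz
    rw [min_eq_left (le_of_lt hz)]
  · have h0 : semidiscPerimeter (min y (1 / 2)) = 0 := by
      rw [min_eq_right hy.le]
      norm_num [semidiscPerimeter]
    rw [h0]
    refine (hasDerivAt_const y (semidiscVP (1 / 2))).congr_of_eventuallyEq ?_
    filter_upwards [Ioi_mem_nhds hy] with z hz
    rw [min_eq_right (le_of_lt hz)]

theorem contDiff_semidiscVP_min : ContDiff ℝ 1 fun r => semidiscVP (min r (1 / 2)) := by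
  refine contDiff_one_iff_deriv.2
    ⟨fun r => (hasDerivAt_semidiscVP_min r).differentiableAt, ?_⟩
  rw [show deriv (fun r => semidiscVP (min r (1 / 2))) = _ from
    funext fun r => (hasDerivAt_semidiscVP_min r).deriv]
  exact continuous_semidiscPerimeter_min

theorem deriv_deriv_VP_diskCap {r : ℝ} (hr : 0 < r) (hr' : r < 1 / 2) :
    deriv (deriv (VP (diskCap 1 0))) r = -2 * arccos (r / (1 - r)) - 4 / √(1 - 2 * r) := by
  have h : VP (diskCap 1 0) =ᶠ[𝓝 r] semidiscVP := by
    filter_upwards [Ioo_mem_nhds hr hr'] with z hz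
    exact VP_diskCap_of_le hz.1.le hz.2.le
  have h' : deriv semidiscVP =ᶠ[𝓝 r] semidiscPerimeter := by
    filter_upwards [Iio_mem_nhds hr'] with z hz
    exact (hasDerivAt_semidiscVP hz).deriv
  rw [h.deriv.deriv_eq, h'.deriv_eq, (hasDerivAt_semidiscPerimeter hr').deriv]

theorem tendsto_deriv_deriv_VP_diskCap :
    Tendsto (fun r => deriv (deriv (VP (diskCap 1 0))) r) (𝓝[<] (1 / 2 : ℝ)) atBot := by
  have hs : Tendsto (fun r : ℝ => √(1 - 2 * r)) (𝓝[<] (1 / 2)) (𝓝[>] 0) := by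
    refine tendsto_nhdsWithin_iff.2 ⟨?_, ?_⟩
    · have : Continuous fun r : ℝ => √(1 - 2 * r) := by fun_prop
      simpa using (this.tendsto (1 / 2)).mono_left nhdsWithin_le_nhds
    · filter_upwards [self_mem_nhdsWithin] with r hr
      exact sqrt_pos.2 (by linarith [mem_Iio.1 hr])
  have h : Tendsto (fun r : ℝ => -(4 * (√(1 - 2 * r))⁻¹)) (𝓝[<] (1 / 2)) atBot :=
    tendsto_neg_atTop_atBot.comp ((tendsto_inv_nhdsGT_zero.comp hs).const_mul_atTop four_pos)
  refine tendsto_atBot_mono' _ ?_ h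
  filter_upwards [Ioo_mem_nhdsLT (show (0 : ℝ) < 1 / 2 by norm_num)] with r hr
  rw [deriv_deriv_VP_diskCap hr.1 hr.2, div_eq_mul_inv 4]
  linarith [arccos_nonneg (r / (1 - r))]

/-- For the closed unit semidisc `P`,
`V_P(r) = π/2 - (1-r)² arccos(r/(1-r)) + r√(1-2r)` on `[0,1/2]`, `V_P(r) = π/2` for
`r ≥ 1/2`; `V_P` is `C¹` on `[0,∞)` but not `C²`, and `V_P''(r) → -∞` as `r → (1/2)⁻`. -/
theorem statement13 (P : Set (EuclideanSpace ℝ (Fin 2)))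
    (hP : P = {x : EuclideanSpace ℝ (Fin 2) | x 0 ^ 2 + x 1 ^ 2 ≤ 1 ∧ 0 ≤ x 1}) :
    (∀ r ∈ Icc (0 : ℝ) (1 / 2),
      VP P r = π / 2 - (1 - r) ^ 2 * arccos (r / (1 - r)) + r * Real.sqrt (1 - 2 * r)) ∧
    (∀ r : ℝ, 1 / 2 ≤ r → VP P r = π / 2) ∧
    ContDiffOn ℝ 1 (VP P) (Ici 0) ∧
    ¬ ContDiffOn ℝ 2 (VP P) (Ici 0) ∧
    Tendsto (fun r => deriv (deriv (VP P)) r) (𝓝[<] (1 / 2 : ℝ)) atBot := by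
  obtain rfl : P = diskCap 1 0 := by rw [hP, diskCap, one_pow]
  refine ⟨fun r hr => VP_diskCap_of_le hr.1 hr.2, fun r hr => VP_diskCap_of_ge hr,
    contDiff_semidiscVP_min.contDiffOn.congr fun r hr => VP_diskCap hr, fun h => ?_,
    tendsto_deriv_deriv_VP_diskCap⟩
  have h₁ : ContDiffOn ℝ 1 (deriv (VP (diskCap 1 0))) (Ioi 0) :=
    ((contDiffOn_succ_iff_deriv_of_isOpen (n := 1) isOpen_Ioi).1
      (by simpa [one_add_one_eq_two] using h.mono Ioi_subset_Ici_self)).2.2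
  have h₂ : ContinuousAt (deriv (deriv (VP (diskCap 1 0)))) (1 / 2) :=
    (h₁.continuousOn_deriv_of_isOpen isOpen_Ioi le_rfl).continuousAt
      (Ioi_mem_nhds (by norm_num))
  exact not_tendsto_nhds_of_tendsto_atBot tendsto_deriv_deriv_VP_diskCap _
    (h₂.tendsto.mono_left nhdsWithin_le_nhds)
end

section
/- Let P be a convex polygon in ℝ² with n vertices, and let α_1, …, α_n be its outer angles (at each vertex, the outer angle α_i satisfies ⟨N, N'⟩ = cos α_i where N, N' are the inner unit normals of the two edges meeting at that vertex). Then there exists ε > 0 such that for all 0 ≤ r ≤ ε, the area of the inner r-neighborhood satisfies V_P(r) = perimeter(P)·r − (Σ_{i=1}^n tan(α_i/2))·r². -/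
open MeasureTheory Metric Set Real
open scoped RealInnerProductSpace

/-- In the half-plane of positive `⟪w, ·⟫`, a vector whose slope relative to `w` lies between those
of two others is in their cone. -/
theorem exists_eq_smul_add_smul_of_slope_le {a b c w : EuclideanSpace ℝ (Fin 2)}
    (ha : 0 < ⟪w, a⟫) (hb : 0 < ⟪w, b⟫) (hc : 0 < ⟪w, c⟫)
    (hba : (w 0 * b 1 - w 1 * b 0) / ⟪w, b⟫ ≤ (w 0 * a 1 - w 1 * a 0) / ⟪w, a⟫)
    (hac : (w 0 * a 1 - w 1 * a 0) / ⟪w, a⟫ ≤ (w 0 * c 1 - w 1 * c 0) / ⟪w, c⟫) :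
    ∃ p q : ℝ, 0 ≤ p ∧ 0 ≤ q ∧ a = p • b + q • c := by
  have hmem := Icc_subset_segment (𝕜 := ℝ) ⟨hba, hac⟩
  obtain ⟨p, q, hp, hq, hpq, h⟩ := hmem
  refine ⟨p * (⟪w, a⟫ / ⟪w, b⟫), q * (⟪w, a⟫ / ⟪w, c⟫), by positivity, by positivity, ?_⟩
  have hw : 0 < w 0 ^ 2 + w 1 ^ 2 := by
    by_contra! hcon
    have h0 : w 0 = 0 := by nlinarith [sq_nonneg (w 0), sq_nonneg (w 1)]
    have h1 : w 1 = 0 := by nlinarith [sq_nonneg (w 0), sq_nonneg (w 1)]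
    simp [EuclideanSpace.inner_eq_star_dotProduct, dotProduct, Fin.sum_univ_two, h0, h1] at ha
  have e : ∀ x : EuclideanSpace ℝ (Fin 2), ⟪w, x⟫ = w 0 * x 0 + w 1 * x 1 := fun x => by
    simp [EuclideanSpace.inner_eq_star_dotProduct, dotProduct, Fin.sum_univ_two]; ring
  have h1 : w 0 * a 0 + w 1 * a 1 = p * (⟪w, a⟫ / ⟪w, b⟫) * (w 0 * b 0 + w 1 * b 1) +
      q * (⟪w, a⟫ / ⟪w, c⟫) * (w 0 * c 0 + w 1 * c 1) := by
    rw [← e, ← e, ← e]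
    field_simp
    linarith
  have h2 : w 0 * a 1 - w 1 * a 0 = p * (⟪w, a⟫ / ⟪w, b⟫) * (w 0 * b 1 - w 1 * b 0) +
      q * (⟪w, a⟫ / ⟪w, c⟫) * (w 0 * c 1 - w 1 * c 0) := by
    simp only [smul_eq_mul] at h
    have h3 : w 0 * a 1 - w 1 * a 0 = ((w 0 * a 1 - w 1 * a 0) / ⟪w, a⟫) * ⟪w, a⟫ := by
      field_simp
    rw [h3, ← h]
    ring
  generalize p * (⟪w, a⟫ / ⟪w, b⟫) = P at *
  generalize q * (⟪w, a⟫ / ⟪w, c⟫) = Q at *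
  ext i
  fin_cases i
  · simp
    apply mul_left_cancel₀ hw.ne'
    linear_combination w 0 * h1 - w 1 * h2
  · simp
    apply mul_left_cancel₀ hw.ne'
    linear_combination w 1 * h1 + w 0 * h2

/-- Of three vectors of the plane in a common open half-plane, one is in the cone of the others. -/
theorem exists_mem_cone_of_inner_pos {a b c w : EuclideanSpace ℝ (Fin 2)}
    (ha : 0 < ⟪w, a⟫) (hb : 0 < ⟪w, b⟫) (hc : 0 < ⟪w, c⟫) :
    (∃ p q : ℝ, 0 ≤ p ∧ 0 ≤ q ∧ a = p • b + q • c) ∨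
    (∃ p q : ℝ, 0 ≤ p ∧ 0 ≤ q ∧ b = p • c + q • a) ∨
    (∃ p q : ℝ, 0 ≤ p ∧ 0 ≤ q ∧ c = p • a + q • b) := by
  have swap : ∀ {x y z : EuclideanSpace ℝ (Fin 2)},
      (∃ p q : ℝ, 0 ≤ p ∧ 0 ≤ q ∧ x = p • y + q • z) →
      ∃ p q : ℝ, 0 ≤ p ∧ 0 ≤ q ∧ x = p • z + q • y :=
    fun ⟨p, q, hp, hq, h⟩ => ⟨q, p, hq, hp, h.trans (add_comm _ _)⟩
  rcases le_total ((w 0 * a 1 - w 1 * a 0) / ⟪w, a⟫) ((w 0 * b 1 - w 1 * b 0) / ⟪w, b⟫)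
    with hab | hab <;>
  rcases le_total ((w 0 * b 1 - w 1 * b 0) / ⟪w, b⟫) ((w 0 * c 1 - w 1 * c 0) / ⟪w, c⟫)
    with hbc | hbc <;>
  rcases le_total ((w 0 * a 1 - w 1 * a 0) / ⟪w, a⟫) ((w 0 * c 1 - w 1 * c 0) / ⟪w, c⟫)
    with hac | hac
  · exact .inr (.inl (swap (exists_eq_smul_add_smul_of_slope_le hb ha hc hab hbc)))
  · exact .inr (.inl (swap (exists_eq_smul_add_smul_of_slope_le hb ha hc hab hbc)))
  · exact .inr (.inr (exists_eq_smul_add_smul_of_slope_le hc ha hb hac hbc))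
  · exact .inl (swap (exists_eq_smul_add_smul_of_slope_le ha hc hb hac hab))
  · exact .inl (exists_eq_smul_add_smul_of_slope_le ha hb hc hab hac)
  · exact .inr (.inr (swap (exists_eq_smul_add_smul_of_slope_le hc hb ha hbc hac)))
  · exact .inr (.inl (exists_eq_smul_add_smul_of_slope_le hb hc ha hbc hab))
  · exact .inr (.inl (exists_eq_smul_add_smul_of_slope_le hb hc ha hbc hab))

theorem interior_setOf_forall_le_inner {ι : Type*} [Finite ι] {E : Type*} [NormedAddCommGroup E]
    [InnerProductSpace ℝ E] {N : ι → E} (c : ι → ℝ) (hN : ∀ j, ‖N j‖ = 1) :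
    interior {x : E | ∀ j, c j ≤ ⟪x, N j⟫} = {x : E | ∀ j, c j < ⟪x, N j⟫} := by
  have hop : IsOpen {x : E | ∀ j, c j < ⟪x, N j⟫} := by
    simp only [ofPred_forall]
    exact isOpen_iInter_of_finite fun j => isOpen_lt (by fun_prop) (by fun_prop)
  apply Subset.antisymm
  · intro x hx j
    have hev : ∀ᶠ t : ℝ in nhdsWithin 0 (Ioi 0),
        x - t • N j ∈ {x : E | ∀ j, c j ≤ ⟪x, N j⟫} := by
      have hcont : Continuous fun t : ℝ => x - t • N j := by fun_prop
      have h0 : Filter.Tendsto (fun t : ℝ => x - t • N j) (nhds 0) (nhds x) := by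
        simpa using hcont.tendsto 0
      exact nhdsWithin_le_nhds (h0.eventually (mem_interior_iff_mem_nhds.1 hx))
    obtain ⟨t, ht, ht0⟩ := (hev.and self_mem_nhdsWithin).exists
    have := ht j
    simp only [inner_sub_left, inner_smul_left, real_inner_self_eq_norm_sq, hN] at this
    simp at this ht0
    linarith
  · exact interior_maximal (fun x hx j => (hx j).le) hop

theorem frontier_setOf_forall_le_inner {ι : Type*} [Finite ι] {E : Type*} [NormedAddCommGroup E]
    [InnerProductSpace ℝ E] {N : ι → E} (c : ι → ℝ) (hN : ∀ j, ‖N j‖ = 1) :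
    frontier {x : E | ∀ j, c j ≤ ⟪x, N j⟫} =
      {x | (∀ j, c j ≤ ⟪x, N j⟫) ∧ ∃ j, ⟪x, N j⟫ = c j} := by
  have hcl : IsClosed {x : E | ∀ j, c j ≤ ⟪x, N j⟫} := by
    simp only [ofPred_forall]
    exact isClosed_iInter fun j => isClosed_le (by fun_prop) (by fun_prop)
  rw [hcl.frontier_eq, interior_setOf_forall_le_inner c hN]
  ext x
  simp only [mem_sdiff, mem_ofPred_eq, not_forall, not_lt]
  refine and_congr_right fun h => exists_congr fun j => ?_
  exact ⟨fun h' => le_antisymm h' (h j), fun h' => h'.le⟩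

theorem le_infDist_frontier_iff {ι : Type*} [Finite ι] [Nonempty ι] {E : Type*}
    [NormedAddCommGroup E] [InnerProductSpace ℝ E] {N : ι → E} {c : ι → ℝ}
    (hN : ∀ j, ‖N j‖ = 1) {x : E} (hx : ∀ j, c j ≤ ⟪x, N j⟫) (r : ℝ) :
    r ≤ infDist x (frontier {x : E | ∀ j, c j ≤ ⟪x, N j⟫}) ↔ ∀ j, r ≤ ⟪x, N j⟫ - c j := by
  obtain ⟨j, hj⟩ := Finite.exists_min fun j => ⟪x, N j⟫ - c j
  rw [frontier_setOf_forall_le_inner c hN]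
  set s := ⟪x, N j⟫ - c j with hs
  have hs0 : 0 ≤ s := sub_nonneg.2 (hx j)
  have hmem : x - s • N j ∈ {x | (∀ j, c j ≤ ⟪x, N j⟫) ∧ ∃ j, ⟪x, N j⟫ = c j} := by
    refine ⟨fun i => ?_, j, ?_⟩
    · have h1 : ⟪N j, N i⟫ ≤ 1 := by
        simpa [hN] using real_inner_le_norm (N j) (N i)
      have h2 := hj i
      rw [inner_sub_left, real_inner_smul_left]
      nlinarith
    · rw [inner_sub_left, real_inner_smul_left, real_inner_self_eq_norm_sq, hN, hs]
      ring
  constructor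
  · intro h i
    have h1 := infDist_le_dist_of_mem (x := x) hmem
    have h2 : dist x (x - s • N j) = s := by
      simp [norm_smul, hN, abs_of_nonneg hs0]
    rw [h2] at h1
    exact (h.trans h1).trans (hj i)
  · intro h
    refine (le_infDist ⟨_, hmem⟩).2 ?_
    rintro y ⟨-, i, hi⟩
    have h1 : ⟪x - y, N i⟫ ≤ dist x y := by
      simpa [hN, dist_eq_norm] using real_inner_le_norm (x - y) (N i)
    rw [inner_sub_left, hi] at h1
    exact (h i).trans h1

theorem volume_setOf_inner_eq {E : Type*} [NormedAddCommGroup E] [InnerProductSpace ℝ E]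
    [FiniteDimensional ℝ E] [MeasurableSpace E] [BorelSpace E] {u : E} (hu : u ≠ 0) (a : ℝ) :
    volume {x : E | ⟪x, u⟫ = a} = 0 := by
  rcases Set.eq_empty_or_nonempty {x : E | ⟪x, u⟫ = a} with h | ⟨x₀, hx₀⟩
  · simp [h]
  have hset : {x : E | ⟪x, u⟫ = a} =
      (AffineSubspace.mk' x₀ (LinearMap.ker (innerₗ E u)) : Set E) := by
    ext x
    simp only [mem_ofPred_eq] at hx₀
    have h : ⟪x, u⟫ = a ↔ ⟪x - x₀, u⟫ = 0 := by rw [inner_sub_left, hx₀, sub_eq_zero]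
    simpa [AffineSubspace.mem_mk', real_inner_comm _ u] using h
  rw [hset]
  refine Measure.addHaar_affineSubspace _ _ fun htop => ?_
  have hd := congrArg AffineSubspace.direction htop
  rw [AffineSubspace.direction_mk', AffineSubspace.direction_top] at hd
  have : u ∈ LinearMap.ker (innerₗ E u) := hd ▸ Submodule.mem_top
  simp [hu] at this

theorem volume_preimage_regionBetween (b : OrthonormalBasis (Fin 2) ℝ (EuclideanSpace ℝ (Fin 2)))
    (u : EuclideanSpace ℝ (Fin 2)) {f g : ℝ → ℝ} {r : ℝ} (hr : 0 ≤ r) (hf : Continuous f)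
    (hg : Continuous g) (hfg : ∀ s ∈ Ioo 0 r, f s ≤ g s) :
    (volume {x : EuclideanSpace ℝ (Fin 2) |
      ((⟪x - u, b 0⟫, ⟪x - u, b 1⟫) : ℝ × ℝ) ∈ regionBetween f g (Ioo 0 r)}).toReal =
      ∫ s in (0 : ℝ)..r, (g s - f s) := by
  have hmp : MeasurePreserving (fun x : EuclideanSpace ℝ (Fin 2) =>
      ((⟪x - u, b 0⟫, ⟪x - u, b 1⟫) : ℝ × ℝ)) volume volume := by
    have h := ((volume_preserving_finTwoArrow ℝ).comp
      (EuclideanSpace.volume_preserving_symm_measurableEquiv_toLp (Fin 2))).comp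
      (b.measurePreserving_repr.comp (measurePreserving_sub_right volume u))
    convert h using 1
    ext x <;> simp [b.repr_apply_apply, real_inner_comm, inner_sub_left, MeasurableEquiv.finTwoArrow]
  have hmeas : MeasurableSet (regionBetween f g (Ioo 0 r)) :=
    measurableSet_regionBetween hf.measurable hg.measurable measurableSet_Ioo
  have hpre := hmp.measure_preimage hmeas.nullMeasurableSet
  have hvol := volume_regionBetween_eq_integral (μ := volume) (s := Ioo (0 : ℝ) r)
    ((hf.integrableOn_Icc (a := 0) (b := r)).mono_set Ioo_subset_Icc_self)
    ((hg.integrableOn_Icc (a := 0) (b := r)).mono_set Ioo_subset_Icc_self) measurableSet_Ioo hfg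
  have hset : {x : EuclideanSpace ℝ (Fin 2) |
      ((⟪x - u, b 0⟫, ⟪x - u, b 1⟫) : ℝ × ℝ) ∈ regionBetween f g (Ioo 0 r)} =
      (fun x : EuclideanSpace ℝ (Fin 2) =>
        ((⟪x - u, b 0⟫, ⟪x - u, b 1⟫) : ℝ × ℝ)) ⁻¹' regionBetween f g (Ioo 0 r) := rfl
  rw [hset, hpre, Measure.volume_eq_prod, hvol, ENNReal.toReal_ofReal,
    intervalIntegral.integral_of_le hr, integral_Ioc_eq_integral_Ioo]
  · rfl
  · exact setIntegral_nonneg measurableSet_Ioo fun s hs => sub_nonneg.2 (hfg s hs)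

theorem one_sub_cos_eq_tan_half_mul_sin {a : ℝ} (ha : cos (a / 2) ≠ 0) :
    1 - cos a = tan (a / 2) * sin a := by
  obtain ⟨b, rfl⟩ : ∃ b, a = 2 * b := ⟨a / 2, by ring⟩
  rw [mul_div_cancel_left₀ _ two_ne_zero] at *
  rw [tan_eq_sin_div_cos, sin_two_mul, cos_two_mul, cos_sq']
  field_simp
  ring

/-- Three lines bounding a planar region with nonempty interior, none of them redundant,
have no common point. -/
theorem eq_or_eq_of_inner_eq {ι : Type*} {N : ι → EuclideanSpace ℝ (Fin 2)} {c : ι → ℝ}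
    (hred : ∀ j, ∃ x, (∀ i, i ≠ j → c i ≤ ⟪x, N i⟫) ∧ ⟪x, N j⟫ < c j)
    {p : EuclideanSpace ℝ (Fin 2)} (hp : ∀ j, c j < ⟪p, N j⟫) {v : EuclideanSpace ℝ (Fin 2)}
    {i j k : ι} (hi : ⟪v, N i⟫ = c i) (hj : ⟪v, N j⟫ = c j) (hk : ⟪v, N k⟫ = c k) (hjk : j ≠ k) :
    i = j ∨ i = k := by
  by_contra! hcon
  obtain ⟨hij, hik⟩ := hcon
  have hcone : ∀ {a b d : ι}, ⟪v, N a⟫ = c a → ⟪v, N b⟫ = c b → ⟪v, N d⟫ = c d → b ≠ a → d ≠ a →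
      ¬ ∃ r s : ℝ, 0 ≤ r ∧ 0 ≤ s ∧ N a = r • N b + s • N d := by
    rintro a b d ha hb hd hba hda ⟨r, s, hr, hs, hN⟩
    obtain ⟨x, hx, hxa⟩ := hred a
    rw [← ha, hN] at hxa
    simp only [inner_add_right, real_inner_smul_right] at hxa
    have h1 := mul_le_mul_of_nonneg_left (hb.trans_le (hx b hba)) hr
    have h2 := mul_le_mul_of_nonneg_left (hd.trans_le (hx d hda)) hs
    linarith
  have hpos : ∀ l, ⟪v, N l⟫ = c l → 0 < ⟪p - v, N l⟫ := fun l hl => by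
    rw [inner_sub_left, hl]
    exact sub_pos.2 (hp l)
  rcases exists_mem_cone_of_inner_pos (hpos i hi) (hpos j hj) (hpos k hk) with h | h | h
  · exact hcone hi hj hk hij.symm hik.symm h
  · exact hcone hj hk hi hjk.symm hij h
  · exact hcone hk hi hj hik hjk h

theorem injective_of_irredundant {ι E : Type*} [NormedAddCommGroup E] [InnerProductSpace ℝ E]
    {N : ι → E} {c : ι → ℝ}
    (hred : ∀ j, ∃ x, (∀ i, i ≠ j → c i ≤ ⟪x, N i⟫) ∧ ⟪x, N j⟫ < c j) :
    Function.Injective N := by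
  intro i j hij
  by_contra hne
  obtain ⟨x, hx, hxi⟩ := hred i
  obtain ⟨y, hy, hyj⟩ := hred j
  have h1 := hx j (Ne.symm hne)
  have h2 := hy i hne
  rw [hij] at hxi h2
  linarith

theorem exists_edge_frame {N M₁ M₂ u w : EuclideanSpace ℝ (Fin 2)} {α β : ℝ} (hN : ‖N‖ = 1)
    (hM₁ : ‖M₁‖ = 1) (hM₂ : ‖M₂‖ = 1) (hα : α ∈ Ioo 0 π) (hβ : β ∈ Ioo 0 π)
    (h₁ : cos α = ⟪N, M₁⟫) (h₂ : cos β = ⟪N, M₂⟫) (huw : ⟪w - u, N⟫ = 0)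
    (hpos : 0 < ⟪w - u, M₁⟫) (hneg : ⟪w - u, M₂⟫ < 0) :
    ∃ b : OrthonormalBasis (Fin 2) ℝ (EuclideanSpace ℝ (Fin 2)),
      b 0 = N ∧ w - u = dist u w • b 1 ∧ ⟪b 1, M₁⟫ = sin α ∧ ⟪b 1, M₂⟫ = -sin β := by
  have hne : w - u ≠ 0 := fun h => by simp [h] at hpos
  have hL : 0 < dist u w := by rw [dist_comm, dist_eq_norm]; exact norm_pos_iff.2 hne
  have hLw : ‖w - u‖ = dist u w := by rw [dist_comm, dist_eq_norm]
  have hon : Orthonormal ℝ ((univ : Set (Fin 2)).domRestrict ![N, (dist u w)⁻¹ • (w - u)]) := by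
    refine ⟨?_, ?_⟩
    · rintro ⟨i, -⟩
      fin_cases i
      · simpa using hN
      · simp [norm_smul, hLw, hL.ne']
    · rintro ⟨i, -⟩ ⟨k, -⟩
      fin_cases i <;> fin_cases k <;> intro hik
      · exact absurd rfl hik
      · simp [inner_smul_right, (real_inner_comm _ _).trans huw]
      · simp [inner_smul_left, huw]
      · exact absurd rfl hik
  obtain ⟨b, hb⟩ := hon.exists_orthonormalBasis_extension_of_card_eq (by simp)
  have hb0 : b 0 = N := by simpa using hb 0 (mem_univ _)
  have hb1 : b 1 = (dist u w)⁻¹ • (w - u) := by simpa using hb 1 (mem_univ _)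
  have hwu : w - u = dist u w • b 1 := by rw [hb1, smul_inv_smul₀ hL.ne']
  have hsq : ∀ M : EuclideanSpace ℝ (Fin 2), ‖M‖ = 1 → ⟪N, M⟫ ^ 2 + ⟪b 1, M⟫ ^ 2 = 1 := by
    intro M hM
    have h := b.sum_inner_mul_inner M M
    rw [Fin.sum_univ_two, real_inner_self_eq_norm_sq, hM, hb0, real_inner_comm _ M,
      real_inner_comm _ M] at h
    linarith
  have hb1sign : ∀ M : EuclideanSpace ℝ (Fin 2), ⟪w - u, M⟫ = dist u w * ⟪b 1, M⟫ := fun M => by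
    rw [hwu, real_inner_smul_left]
  refine ⟨b, hb0, hwu, ?_, ?_⟩
  · rw [hb1sign] at hpos
    have h := hsq M₁ hM₁
    rw [← h₁] at h
    refine (pow_left_inj₀ (pos_of_mul_pos_right hpos hL.le).le (sin_pos_of_mem_Ioo hα).le
      two_ne_zero).1 ?_
    linarith [sin_sq_add_cos_sq α]
  · rw [hb1sign] at hneg
    have h := hsq M₂ hM₂
    rw [← h₂] at h
    have h3 : -⟪b 1, M₂⟫ = sin β := by
      refine (pow_left_inj₀ (by nlinarith) (sin_pos_of_mem_Ioo hβ).le two_ne_zero).1 ?_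
      linarith [sin_sq_add_cos_sq β]
    linarith

/-- The half-planes `c j ≤ ⟪x, N j⟫` bound a polygon whose only vertex on both the edges
`j` and `σ j` is `v j`, with edge `σ j` following edge `j`. -/
structure IsCyclicPolygon {ι : Type*} (N : ι → EuclideanSpace ℝ (Fin 2)) (c : ι → ℝ)
    (σ : Equiv.Perm ι) (v : ι → EuclideanSpace ℝ (Fin 2)) : Prop where
  norm_normal : ∀ j, ‖N j‖ = 1
  next_ne : ∀ j, σ j ≠ j
  next_next_ne : ∀ j, σ (σ j) ≠ j
  inner_vertex : ∀ j, ⟪v j, N j⟫ = c j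
  inner_vertex_next : ∀ j, ⟪v j, N (σ j)⟫ = c (σ j)
  lt_inner_vertex : ∀ j i, i ≠ j → i ≠ σ j → c i < ⟪v j, N i⟫

namespace IsCyclicPolygon

variable {ι : Type*} {N : ι → EuclideanSpace ℝ (Fin 2)} {c α : ι → ℝ} {σ : Equiv.Perm ι}
  {v : ι → EuclideanSpace ℝ (Fin 2)}

theorem le_inner_vertex (h : IsCyclicPolygon N c σ v) (j i : ι) : c i ≤ ⟪v j, N i⟫ := by
  by_cases h1 : i = j
  · exact h1 ▸ (h.inner_vertex i).ge
  by_cases h2 : i = σ j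
  · exact h2 ▸ (h.inner_vertex_next j).ge
  exact (h.lt_inner_vertex j i h1 h2).le

theorem exists_frame (h : IsCyclicPolygon N c σ v) (hα : ∀ j, α j ∈ Ioo (0 : ℝ) π)
    (hcos : ∀ j, cos (α j) = ⟪N j, N (σ j)⟫) (j : ι) :
    ∃ b : OrthonormalBasis (Fin 2) ℝ (EuclideanSpace ℝ (Fin 2)),
      b 0 = N (σ j) ∧ v (σ j) - v j = dist (v j) (v (σ j)) • b 1 ∧
        ⟪b 1, N j⟫ = sin (α j) ∧ ⟪b 1, N (σ (σ j))⟫ = -sin (α (σ j)) := by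
  refine exists_edge_frame (h.norm_normal _) (h.norm_normal _) (h.norm_normal _) (hα _) (hα _)
    ((hcos j).trans (real_inner_comm _ _)) (hcos (σ j)) ?_ ?_ ?_
  · rw [inner_sub_left, h.inner_vertex, h.inner_vertex_next, sub_self]
  · rw [inner_sub_left, h.inner_vertex]
    exact sub_pos.2 (h.lt_inner_vertex _ _ (h.next_ne j).symm (h.next_next_ne j).symm)
  · rw [inner_sub_left, h.inner_vertex_next]
    exact sub_neg.2 (h.lt_inner_vertex _ _ (h.next_next_ne j) (h.next_ne _))

theorem dist_vertex_pos (h : IsCyclicPolygon N c σ v) (j : ι) : 0 < dist (v j) (v (σ j)) := by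
  refine dist_pos.2 fun heq => ?_
  have h1 := h.lt_inner_vertex (σ j) j (h.next_ne j).symm (h.next_next_ne j).symm
  rw [← heq, h.inner_vertex] at h1
  exact lt_irrefl _ h1

theorem edge_eq_segment (h : IsCyclicPolygon N c σ v) (hα : ∀ j, α j ∈ Ioo (0 : ℝ) π)
    (hcos : ∀ j, cos (α j) = ⟪N j, N (σ j)⟫) (j : ι) :
    {x | (∀ i, c i ≤ ⟪x, N i⟫) ∧ ⟪x, N (σ j)⟫ = c (σ j)} = segment ℝ (v j) (v (σ j)) := by
  apply Subset.antisymm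
  · rintro x ⟨hx, hxj⟩
    obtain ⟨b, hb0, hb1, hs, hs'⟩ := h.exists_frame hα hcos j
    have hL := h.dist_vertex_pos j
    set L := dist (v j) (v (σ j))
    have hx0 : ⟪x - v j, b 0⟫ = 0 := by
      rw [hb0, inner_sub_left, hxj, h.inner_vertex_next, sub_self]
    set t := ⟪x - v j, b 1⟫ with ht
    have hxv : x - v j = t • b 1 := by
      have := b.sum_repr' (x - v j)
      rw [Fin.sum_univ_two, real_inner_comm, hx0, real_inner_comm, ← ht] at this
      simpa using this.symm
    have ht0 : 0 ≤ t := by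
      have h1 : 0 ≤ ⟪x - v j, N j⟫ := by
        rw [inner_sub_left, h.inner_vertex]; exact sub_nonneg.2 (hx j)
      rw [hxv, real_inner_smul_left, hs] at h1
      exact nonneg_of_mul_nonneg_left h1 (sin_pos_of_mem_Ioo (hα j))
    have htL : t ≤ L := by
      have h1 : 0 ≤ ⟪x - v (σ j), N (σ (σ j))⟫ := by
        rw [inner_sub_left, h.inner_vertex_next]; exact sub_nonneg.2 (hx _)
      have h2 : x - v (σ j) = (t - L) • b 1 := by
        rw [sub_smul, ← hxv, ← hb1]; abel
      rw [h2, real_inner_smul_left, hs'] at h1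
      nlinarith [sin_pos_of_mem_Ioo (hα (σ j))]
    rw [segment_eq_image']
    refine ⟨t / L, ⟨by positivity, (div_le_one hL).2 htL⟩, ?_⟩
    simp only
    rw [hb1, smul_smul, div_mul_cancel₀ _ hL.ne', ← hxv]
    abel
  · rintro x ⟨p, q, hp, hq, hpq, rfl⟩
    simp only [mem_ofPred_eq, inner_add_left, real_inner_smul_left]
    refine ⟨fun i => ?_, ?_⟩
    · have h1 := h.le_inner_vertex j i
      have h2 := h.le_inner_vertex (σ j) i
      calc c i = p * c i + q * c i := by rw [← add_mul, hpq, one_mul]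
        _ ≤ _ := by gcongr
    · rw [h.inner_vertex, h.inner_vertex_next, ← add_mul, hpq, one_mul]

/-- A point of the edge `σ j` lying on another edge is an end point of the edge `σ j`. -/
theorem eq_vertex_of_mem_edges (h : IsCyclicPolygon N c σ v) {j i : ι} (hij : i ≠ σ j)
    {x : EuclideanSpace ℝ (Fin 2)} (hx : x ∈ segment ℝ (v j) (v (σ j))) (hxi : ⟪x, N i⟫ = c i) :
    x = v j ∨ x = v (σ j) := by
  obtain ⟨p, q, hp, hq, hpq, rfl⟩ := hx
  rw [inner_add_left, real_inner_smul_left, real_inner_smul_left] at hxi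
  have h1 := h.le_inner_vertex j i
  have h2 := h.le_inner_vertex (σ j) i
  have h3 : c i < ⟪v j, N i⟫ ∨ c i < ⟪v (σ j), N i⟫ := by
    by_cases hi : i = j
    · exact .inr (h.lt_inner_vertex _ _ hij (hi ▸ (h.next_next_ne i).symm))
    · exact .inl (h.lt_inner_vertex _ _ hi hij)
  have hci : c i = p * c i + q * c i := by rw [← add_mul, hpq, one_mul]
  rcases h3 with h3 | h3
  · right
    have hp0 : p = 0 := by
      by_contra hne
      have := mul_lt_mul_of_pos_left h3 (hp.lt_of_ne' hne)
      have := mul_le_mul_of_nonneg_left h2 hq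
      linarith
    have hq1 : q = 1 := by linarith
    simp [hp0, hq1]
  · left
    have hq0 : q = 0 := by
      by_contra hne
      have := mul_lt_mul_of_pos_left h3 (hq.lt_of_ne' hne)
      have := mul_le_mul_of_nonneg_left h1 hp
      linarith
    have hp1 : p = 1 := by linarith
    simp [hq0, hp1]

theorem hausdorffMeasure_frontier [Fintype ι] (h : IsCyclicPolygon N c σ v)
    (hα : ∀ j, α j ∈ Ioo (0 : ℝ) π) (hcos : ∀ j, cos (α j) = ⟪N j, N (σ j)⟫) :
    (μH[(1 : ℝ)] (frontier {x | ∀ j, c j ≤ ⟪x, N j⟫})).toReal =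
      ∑ j, dist (v j) (v (σ j)) := by
  have hfr : frontier {x | ∀ j, c j ≤ ⟪x, N j⟫} = ⋃ j, segment ℝ (v j) (v (σ j)) := by
    rw [frontier_setOf_forall_le_inner c h.norm_normal]
    ext x
    simp only [← h.edge_eq_segment hα hcos, mem_iUnion, mem_ofPred_eq, exists_and_left]
    exact and_congr_right fun _ => σ.surjective.exists
  have hdisj : Pairwise (Function.onFun (AEDisjoint (μH[(1 : ℝ)]))
      fun j => segment ℝ (v j) (v (σ j))) := by
    intro i j hij
    have hsub : segment ℝ (v i) (v (σ i)) ∩ segment ℝ (v j) (v (σ j)) ⊆ {v i, v (σ i)} := by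
      rintro x ⟨hxi, hxj⟩
      rw [← h.edge_eq_segment hα hcos] at hxj
      exact h.eq_vertex_of_mem_edges (fun he => hij (σ.injective he).symm) hxi hxj.2
    have := Measure.nullSingletonClass_hausdorff (EuclideanSpace ℝ (Fin 2)) (d := 1) one_pos
    exact measure_mono_null hsub (Set.Finite.measure_zero (by simp) _)
  rw [hfr, measure_iUnion₀ hdisj fun j => ?_, tsum_fintype, ENNReal.toReal_sum]
  · simp [hausdorffMeasure_segment, edist_dist]
  · simp [hausdorffMeasure_segment, edist_ne_top]
  · rw [← h.edge_eq_segment hα hcos]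
    refine MeasurableSet.nullMeasurableSet (IsClosed.measurableSet ?_)
    rw [Set.ofPred_and, Set.ofPred_forall]
    exact (isClosed_iInter fun j => isClosed_le (by fun_prop) (by fun_prop)).inter
      (isClosed_eq (by fun_prop) (by fun_prop))
/-- The part of the strip of width `r` along the edge `σ j` which is closer to that edge than to
any other one is a trapezoid for small `r`. -/
theorem volume_strip [Finite ι] (h : IsCyclicPolygon N c σ v)
    (hα : ∀ j, α j ∈ Ioo (0 : ℝ) π) (hcos : ∀ j, cos (α j) = ⟪N j, N (σ j)⟫) (j : ι) :
    ∀ᶠ r in nhdsWithin (0 : ℝ) (Ici 0),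
      (volume {x | 0 < ⟪x, N (σ j)⟫ - c (σ j) ∧ ⟪x, N (σ j)⟫ - c (σ j) < r ∧
        ∀ i, i ≠ σ j → ⟪x, N (σ j)⟫ - c (σ j) < ⟪x, N i⟫ - c i}).toReal =
      dist (v j) (v (σ j)) * r - (tan (α j / 2) + tan (α (σ j) / 2)) / 2 * r ^ 2 := by
  obtain ⟨b, hb0, hb1, hs, hs'⟩ := h.exists_frame hα hcos j
  have hL := h.dist_vertex_pos j
  have hwu : ∀ M, ⟪v (σ j), M⟫ = ⟪v j, M⟫ + dist (v j) (v (σ j)) * ⟪b 1, M⟫ := fun M => by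
    rw [← real_inner_smul_left, ← hb1, inner_sub_left]; ring
  set L := dist (v j) (v (σ j))
  have hhalf : ∀ k, 0 < tan (α k / 2) ∧ 1 - cos (α k) = tan (α k / 2) * sin (α k) := fun k => by
    obtain ⟨hk0, hkπ⟩ := hα k
    exact ⟨tan_pos_of_pos_of_lt_pi_div_two (by linarith) (by linarith),
      one_sub_cos_eq_tan_half_mul_sin
        (cos_pos_of_mem_Ioo ⟨by linarith, by linarith⟩).ne'⟩
  obtain ⟨hA, hA'⟩ := hhalf j
  obtain ⟨hB, hB'⟩ := hhalf (σ j)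
  set A := tan (α j / 2)
  set B := tan (α (σ j) / 2)
  have hsin := sin_pos_of_mem_Ioo (hα j)
  have hsin' := sin_pos_of_mem_Ioo (hα (σ j))
  have hlin : ∀ k a : ℝ, 0 < a → ∀ᶠ r in nhdsWithin (0 : ℝ) (Ici 0), k * r < a := by
    intro k a ha
    have hcont : Continuous fun r : ℝ => k * r := by fun_prop
    exact nhdsWithin_le_nhds ((hcont.tendsto' 0 0 (mul_zero k)).eventually (gt_mem_nhds ha))
  have hother : ∀ᶠ r in nhdsWithin (0 : ℝ) (Ici 0), ∀ i, i ≠ j → i ≠ σ j → i ≠ σ (σ j) →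
      2 * r < ⟪v j, N i⟫ - c i ∧ 2 * r < ⟪v (σ j), N i⟫ - c i := by
    refine Filter.eventually_all.2 fun i => ?_
    by_cases hi : i ≠ j ∧ i ≠ σ j ∧ i ≠ σ (σ j)
    · filter_upwards [hlin 2 _ (sub_pos.2 (h.lt_inner_vertex j i hi.1 hi.2.1)),
        hlin 2 _ (sub_pos.2 (h.lt_inner_vertex (σ j) i hi.2.1 hi.2.2))] with r h1 h2 _ _ _
      exact ⟨h1, h2⟩
    · exact Filter.Eventually.of_forall fun r h1 h2 h3 => absurd ⟨h1, h2, h3⟩ hi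
  filter_upwards [hlin (A + B) L hL, hother, self_mem_nhdsWithin] with r hr1 hr2 hr0
  replace hr0 : 0 ≤ r := hr0
  have hset : {x | 0 < ⟪x, N (σ j)⟫ - c (σ j) ∧ ⟪x, N (σ j)⟫ - c (σ j) < r ∧
        ∀ i, i ≠ σ j → ⟪x, N (σ j)⟫ - c (σ j) < ⟪x, N i⟫ - c i} =
      {x | ((⟪x - v j, b 0⟫, ⟪x - v j, b 1⟫) : ℝ × ℝ) ∈
        regionBetween (fun s => A * s) (fun s => L - B * s) (Ioo 0 r)} := by
    ext x
    have hgap : ∀ i, ⟪x, N i⟫ - c i = (⟪v j, N i⟫ - c i) +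
        ⟪x - v j, b 0⟫ * ⟪b 0, N i⟫ + ⟪x - v j, b 1⟫ * ⟪b 1, N i⟫ := fun i => by
      have h1 := b.sum_inner_mul_inner (x - v j) (N i)
      rw [Fin.sum_univ_two, inner_sub_left _ _ (N i)] at h1
      linarith
    have hself : ⟪x, N (σ j)⟫ - c (σ j) = ⟪x - v j, b 0⟫ := by
      rw [hb0, inner_sub_left, h.inner_vertex_next]
    have hprev : ⟪x, N j⟫ - c j =
        ⟪x - v j, b 0⟫ * cos (α j) + ⟪x - v j, b 1⟫ * sin (α j) := by
      rw [hgap, h.inner_vertex, hs, hb0, real_inner_comm _ (N (σ j)), ← hcos]; ring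
    have hnext : ⟪x, N (σ (σ j))⟫ - c (σ (σ j)) =
        ⟪x - v j, b 0⟫ * cos (α (σ j)) + (L - ⟪x - v j, b 1⟫) * sin (α (σ j)) := by
      have h1 := h.inner_vertex_next (σ j)
      rw [hwu, hs'] at h1
      rw [hgap, hs', hb0, ← hcos]
      linarith
    simp only [mem_ofPred_eq, regionBetween, hself, mem_Ioo]
    generalize ⟪x - v j, b 0⟫ = s at *
    generalize ⟪x - v j, b 1⟫ = t at *
    rw [← and_assoc]
    refine and_congr_right fun hs0 => ?_
    have hprev' : s < ⟪x, N j⟫ - c j ↔ A * s < t := by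
      have key : ⟪x, N j⟫ - c j - s = (t - A * s) * sin (α j) := by
        rw [hprev]; linear_combination (-s) * hA'
      rw [← sub_pos, key, mul_pos_iff_of_pos_right hsin, sub_pos]
    have hnext' : s < ⟪x, N (σ (σ j))⟫ - c (σ (σ j)) ↔ t < L - B * s := by
      have key : ⟪x, N (σ (σ j))⟫ - c (σ (σ j)) - s = (L - B * s - t) * sin (α (σ j)) := by
        rw [hnext]; linear_combination (-s) * hB'
      rw [← sub_pos, key, mul_pos_iff_of_pos_right hsin', sub_pos]
    rw [← hprev', ← hnext']
    refine ⟨fun hall => ⟨hall _ (h.next_ne j).symm, hall _ (h.next_ne _)⟩, ?_⟩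
    rintro ⟨h1, h2⟩ i hi
    by_cases hij : i = j
    · exact hij ▸ h1
    by_cases hij' : i = σ (σ j)
    · exact hij' ▸ h2
    rw [hprev'] at h1
    rw [hnext'] at h2
    obtain ⟨h3, h4⟩ := hr2 i hij hi hij'
    rw [hwu] at h4
    have ht0 : 0 < t := (mul_pos hA hs0.1).trans h1
    have htL : t < L := h2.trans (sub_lt_self _ (mul_pos hB hs0.1))
    have h5 : 2 * r < ⟪v j, N i⟫ - c i + t * ⟪b 1, N i⟫ := by
      refine lt_of_mul_lt_mul_left ?_ hL.le
      nlinarith [mul_lt_mul_of_pos_left h3 (sub_pos.2 htL), mul_lt_mul_of_pos_left h4 ht0]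
    have h6 : -1 ≤ ⟪b 0, N i⟫ := by
      have := abs_real_inner_le_norm (b 0) (N i)
      rw [b.norm_eq_one, h.norm_normal, one_mul] at this
      exact (abs_le.1 this).1
    rw [hgap]
    nlinarith [hs0.1, hs0.2]
  rw [hset, volume_preimage_regionBetween b (v j) hr0 (by fun_prop) (by fun_prop)]
  · have hint : ∀ s : ℝ, L - B * s - A * s = L - (A + B) * s := fun s => by ring
    simp only [hint]
    rw [intervalIntegral.integral_sub (by simp) (by apply Continuous.intervalIntegrable; fun_prop),
      intervalIntegral.integral_const_mul, integral_id]
    simp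
    ring
  · rintro s ⟨hs0, hsr⟩
    nlinarith

theorem volume_diff [Fintype ι] [Nonempty ι] (h : IsCyclicPolygon N c σ v)
    (hinj : Function.Injective N) (hcomp : IsCompact {x | ∀ j, c j ≤ ⟪x, N j⟫})
    (hα : ∀ j, α j ∈ Ioo (0 : ℝ) π) (hcos : ∀ j, cos (α j) = ⟪N j, N (σ j)⟫) :
    ∀ᶠ r in nhdsWithin (0 : ℝ) (Ici 0),
      (volume {x | (∀ j, c j ≤ ⟪x, N j⟫) ∧ ∃ j, ⟪x, N j⟫ - c j < r}).toReal =
      (∑ j, dist (v j) (v (σ j))) * r - (∑ j, tan (α j / 2)) * r ^ 2 := by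
  have hstrip := Filter.eventually_all.2 fun j => h.volume_strip hα hcos j
  filter_upwards [hstrip] with r hr
  set S : ι → Set (EuclideanSpace ℝ (Fin 2)) := fun k =>
    {x | 0 < ⟪x, N k⟫ - c k ∧ ⟪x, N k⟫ - c k < r ∧
        ∀ i, i ≠ k → ⟪x, N k⟫ - c k < ⟪x, N i⟫ - c i} with hS
  have hne0 : ∀ᵐ x : EuclideanSpace ℝ (Fin 2), ∀ k, ⟪x, N k⟫ ≠ c k := by
    refine ae_all_iff.2 fun k => ?_
    have hk : N k ≠ 0 := norm_ne_zero_iff.1 (by simp [h.norm_normal])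
    exact measure_eq_zero_iff_ae_notMem.1 (volume_setOf_inner_eq hk (c k))
  have hne : ∀ᵐ x : EuclideanSpace ℝ (Fin 2), ∀ k i, i ≠ k →
      ⟪x, N k⟫ - c k ≠ ⟪x, N i⟫ - c i := by
    refine ae_all_iff.2 fun k => ae_all_iff.2 fun i => ?_
    by_cases hik : i = k
    · simp [hik]
    have h0 : N k - N i ≠ 0 := sub_ne_zero.2 fun he => hik (hinj he).symm
    filter_upwards [measure_eq_zero_iff_ae_notMem.1 (volume_setOf_inner_eq h0 (c k - c i))]
      with x hx _ heq
    refine hx ?_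
    rw [inner_sub_right]
    linarith
  have hsub : ∀ k, S k ⊆ {x | ∀ j, c j ≤ ⟪x, N j⟫} := by
    rintro k x ⟨hk0, -, hk⟩ i
    by_cases hik : i = k
    · exact hik ▸ (sub_pos.1 hk0).le
    · exact (sub_pos.1 (hk0.trans (hk i hik))).le
  have hae : ({x | (∀ j, c j ≤ ⟪x, N j⟫) ∧ ∃ j, ⟪x, N j⟫ - c j < r} :
      Set (EuclideanSpace ℝ (Fin 2))) =ᵐ[volume] ⋃ k, S k := by
    refine Filter.eventuallyEq_set.2 ?_
    filter_upwards [hne0, hne] with x hx0 hx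
    simp only [hS, mem_iUnion, mem_ofPred_eq]
    constructor
    · rintro ⟨hle, i, hi⟩
      obtain ⟨k, hk⟩ := Finite.exists_min fun k => ⟪x, N k⟫ - c k
      exact ⟨k, sub_pos.2 ((hle k).lt_of_ne' (hx0 k)), (hk i).trans_lt hi,
        fun l hl => (hk l).lt_of_ne (hx k l hl)⟩
    · rintro ⟨k, hk⟩
      exact ⟨hsub k hk, k, hk.2.1⟩
  have hdisj : Pairwise (Function.onFun Disjoint S) := by
    intro i k hik
    refine Set.disjoint_left.2 fun x hxi hxk => ?_
    exact lt_asymm (hxi.2.2 k hik.symm) (hxk.2.2 i hik)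
  have hmeas : ∀ k, MeasurableSet (S k) := fun k => by
    have h1 : S k = {x | 0 < ⟪x, N k⟫ - c k} ∩ ({x | ⟪x, N k⟫ - c k < r} ∩
        ⋂ i, ⋂ (_ : i ≠ k), {x | ⟪x, N k⟫ - c k < ⟪x, N i⟫ - c i}) := by
      ext x; simp [hS]
    rw [h1]
    refine ((isOpen_lt (by fun_prop) (by fun_prop)).inter
      ((isOpen_lt (by fun_prop) (by fun_prop)).inter
      (isOpen_iInter_of_finite fun i => isOpen_iInter_of_finite fun _ =>
        isOpen_lt (by fun_prop) (by fun_prop)))).measurableSet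
  have hfin : ∀ k ∈ Finset.univ, volume (S (σ k)) ≠ ⊤ := fun k _ =>
    ((measure_mono (hsub _)).trans_lt hcomp.measure_lt_top).ne
  have hsum : ∑ j, tan (α (σ j) / 2) = ∑ j, tan (α j / 2) :=
    Equiv.sum_comp σ fun j => tan (α j / 2)
  rw [measure_congr hae, measure_iUnion hdisj hmeas, tsum_fintype,
    ← Equiv.sum_comp σ fun k => volume (S k), ENNReal.toReal_sum hfin,
    Finset.sum_congr rfl fun k _ => hr k, Finset.sum_sub_distrib, ← Finset.sum_mul,
    ← Finset.sum_mul, ← Finset.sum_div, Finset.sum_add_distrib, hsum, add_self_div_two]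

end IsCyclicPolygon

/-- For a convex polygon `P ⊆ ℝ²` with `n` vertices, cyclically ordered
edges with inner unit normals `N j`, and outer angles `α j` (at the vertex where edges `j`
and `j+1` meet, `cos (α j) = ⟪N j, N (j+1)⟫`), there is `ε > 0` such that for `0 ≤ r ≤ ε`,
`V_P(r) = perimeter(P)·r - (∑ j, tan(α j / 2))·r²`. -/
theorem statement14 {n : ℕ} (hn : 3 ≤ n) (P : Set (EuclideanSpace ℝ (Fin 2)))
    (N : Fin n → EuclideanSpace ℝ (Fin 2)) (c : Fin n → ℝ) (α : Fin n → ℝ)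
    (hN : ∀ j, ‖N j‖ = 1)
    (hP : P = ⋂ j, {x : EuclideanSpace ℝ (Fin 2) | c j ≤ ⟪x, N j⟫})
    (hmin : ∀ j : Fin n,
      (⋂ i ∈ Finset.univ.erase j, {x : EuclideanSpace ℝ (Fin 2) | c i ≤ ⟪x, N i⟫}) ≠ P)
    (hcomp : IsCompact P)
    (hint : (interior P).Nonempty)
    (hα : ∀ j, α j ∈ Ioo (0 : ℝ) π)
    (hcos : ∀ j, Real.cos (α j) = ⟪N j, N (j + ⟨1, by omega⟩)⟫)
    (hadj : ∀ j : Fin n,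
      (P ∩ {x | ⟪x, N j⟫ = c j} ∩ {x | ⟪x, N (j + ⟨1, by omega⟩)⟫ = c (j + ⟨1, by omega⟩)}).Nonempty) :
    ∃ ε > (0 : ℝ), ∀ r ∈ Icc (0 : ℝ) ε,
      VP P r = (μH[(1 : ℝ)] (frontier P)).toReal * r -
        (∑ j, Real.tan (α j / 2)) * r ^ 2 := by
  have hPset : P = {x | ∀ j, c j ≤ ⟪x, N j⟫} := by rw [hP, ofPred_forall]
  obtain ⟨m, rfl⟩ : ∃ m, n = m + 3 := ⟨n - 3, by omega⟩
  set σ : Equiv.Perm (Fin (m + 3)) := Equiv.addRight ⟨1, by omega⟩ with hσ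
  have hσ_next : ∀ j, j + ⟨1, by omega⟩ = σ j := fun j => rfl
  simp only [hσ_next] at hcos hadj
  have hred : ∀ j, ∃ x, (∀ i, i ≠ j → c i ≤ ⟪x, N i⟫) ∧ ⟪x, N j⟫ < c j := by
    intro j
    by_contra! hcon
    refine hmin j (Subset.antisymm (fun x hx => ?_) fun x hx => ?_)
    · have hx' : ∀ i, i ≠ j → c i ≤ ⟪x, N i⟫ := by simpa using hx
      rw [hPset]
      intro i
      by_cases hij : i = j
      · exact hij ▸ hcon x hx'
      · exact hx' i hij
    · rw [hPset] at hx
      simpa using fun i _ => hx i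
  obtain ⟨p, hp⟩ := hint
  rw [hPset, interior_setOf_forall_le_inner c hN] at hp
  choose v hv using hadj
  have hvP : ∀ j i, c i ≤ ⟪v j, N i⟫ := fun j => by
    have h := (hv j).1.1
    rw [hPset] at h
    exact h
  have hnext : ∀ j, σ j ≠ j := fun j h => by
    have h1 : (⟨1, by omega⟩ : Fin (m + 3)) = 0 := add_eq_left.1 h
    simp at h1
  have hpoly : IsCyclicPolygon N c σ v :=
    { norm_normal := hN
      next_ne := hnext
      next_next_ne := fun j h => by
        have h1 : (⟨1, by omega⟩ + ⟨1, by omega⟩ : Fin (m + 3)) = 0 :=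
          add_eq_left.1 ((add_assoc j _ _).symm.trans h)
        rw [Fin.ext_iff, Fin.val_add] at h1
        simp [Nat.mod_eq_of_lt (show 2 < m + 3 by omega)] at h1
      inner_vertex := fun j => (hv j).1.2
      inner_vertex_next := fun j => (hv j).2
      lt_inner_vertex := fun j i hij hiσ => (hvP j i).lt_of_ne' fun h =>
        (eq_or_eq_of_inner_eq hred hp h (hv j).1.2 (hv j).2 (hnext j).symm).elim hij hiσ }
  have hvol := hpoly.volume_diff (injective_of_irredundant hred) (hPset ▸ hcomp) hα hcos
  obtain ⟨ε, hε, hεr⟩ := mem_nhdsGE_iff_exists_Icc_subset.1 hvol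
  refine ⟨ε, hε, fun r hr => ?_⟩
  have hdiff : P \ innerInterior P r =
      {x | (∀ j, c j ≤ ⟪x, N j⟫) ∧ ∃ j, ⟪x, N j⟫ - c j < r} := by
    ext x
    simp only [innerInterior, hPset, mem_sdiff, mem_ofPred_eq, not_and]
    refine and_congr_right fun hx => ?_
    simp only [hx, implies_true, forall_const, le_infDist_frontier_iff hN hx, not_forall, not_le]
  rw [VP, hdiff, hPset, hpoly.hausdorffMeasure_frontier hα hcos]
  exact hεr hr
end
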